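/- arXiv:2108.06724 — 3 statements merged into one kernel-verified Lean document; each statement's English description precedes it below -/
import Mathlib

section
/- Let f : G → G be a graph map and x ∈ G. If ω_f(x) is a solenoid, then ω_f(x) ∩ cl(Per(f)) is uncountable, where Per(f) is the set of all periodic points of f. -/
open Set Filter Topology

/-- An arc in `X` with endpoints `a` and `b`: the image of a continuous injection
of `[0,1]` sending `0` to `a` and `1` to `b`. -/
def IsArcWithEnds {X : Type*} [TopologicalSpace X] (A : Set X) (a b : X) : Prop :=
  ∃ φ : Set.Icc (0:ℝ) 1 → X, Continuous φ ∧ Function.Injective φ ∧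
    Set.range φ = A ∧ φ ⟨0, by norm_num⟩ = a ∧ φ ⟨1, by norm_num⟩ = b

/-- A topological graph: a compact connected (metrizable) space which is a union of
finitely many arcs, any two of which are either disjoint or intersect in exactly one
common endpoint. -/
def IsTopGraph (X : Type*) [TopologicalSpace X] : Prop :=
  CompactSpace X ∧ ConnectedSpace X ∧
  ∃ (n : ℕ) (A : Fin n → Set X) (a b : Fin n → X),
    (∀ i, IsArcWithEnds (A i) (a i) (b i)) ∧
    (⋃ i, A i) = Set.univ ∧
    ∀ i j, i ≠ j →
      A i ∩ A j = ∅ ∨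
      ∃ p, A i ∩ A j = {p} ∧ p ∈ ({a i, b i} : Set X) ∧ p ∈ ({a j, b j} : Set X)

/-- A subgraph of `G`: a closed connected subset which is itself a topological graph. -/
def IsSubgraph {G : Type*} [TopologicalSpace G] (K : Set G) : Prop :=
  IsClosed K ∧ IsConnected K ∧ IsTopGraph ↥K

/-- A periodic subgraph with period `k`: `K, f(K), …, f^{k−1}(K)` are pairwise disjoint
and `f^k(K) = K`. -/
def IsPeriodicSubgraph {G : Type*} [TopologicalSpace G] (f : G → G) (K : Set G) (k : ℕ) :
    Prop :=
  IsSubgraph K ∧ 0 < k ∧ f^[k] '' K = K ∧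
    ∀ i j, i < k → j < k → i ≠ j → Disjoint (f^[i] '' K) (f^[j] '' K)

/-- A cycle of graphs with period `k`: the orbit `⋃_{i<k} f^i(K)` of a periodic
subgraph `K` with period `k`. -/
def IsCycleOfGraphs {G : Type*} [TopologicalSpace G] (f : G → G) (X : Set G) (k : ℕ) :
    Prop :=
  ∃ K, IsPeriodicSubgraph f K k ∧ X = ⋃ i ∈ Finset.range k, f^[i] '' K

/-- The ω-limit set of `x` under `f`. -/
def omegaSet {G : Type*} [TopologicalSpace G] (f : G → G) (x : G) : Set G :=
  ⋂ n : ℕ, closure ((fun m => f^[m] x) '' Set.Ici n)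

/-- `ω(f) = ⋃_{x} ω_f(x)`. -/
def omegaUnion {G : Type*} [TopologicalSpace G] (f : G → G) : Set G :=
  ⋃ x, omegaSet f x

/-- A set `W` is a solenoid for `f` if it is infinite and is contained in cycles of
graphs of arbitrarily large periods. -/
def IsSolenoid {G : Type*} [TopologicalSpace G] (f : G → G) (W : Set G) : Prop :=
  W.Infinite ∧ ∀ n : ℕ, ∃ X k, n ≤ k ∧ IsCycleOfGraphs f X k ∧ W ⊆ X

/-- Two points are separable if they belong to two disjoint periodic subgraphs. -/
def SeparablePoints {G : Type*} [TopologicalSpace G] (f : G → G) (x y : G) : Prop :=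
  ∃ I J kI kJ, IsPeriodicSubgraph f I kI ∧ IsPeriodicSubgraph f J kJ ∧
    Disjoint I J ∧ x ∈ I ∧ y ∈ J

/-- An NS-pair: a pair of distinct points of `ω(f)` contained in a nested sequence of
periodic subgraphs whose periods tend to infinity. -/
def IsNSPair {G : Type*} [TopologicalSpace G] (f : G → G) (x y : G) : Prop :=
  x ≠ y ∧ x ∈ omegaUnion f ∧ y ∈ omegaUnion f ∧
  ∃ (J : ℕ → Set G) (m : ℕ → ℕ),
    (∀ n, IsPeriodicSubgraph f (J n) (m n)) ∧
    (∀ n, J (n + 1) ⊆ J n) ∧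
    Filter.Tendsto m Filter.atTop Filter.atTop ∧
    ∀ n, x ∈ J n ∧ y ∈ J n

/-- The pair `⟨x,y⟩` is proximal. -/
def Proximal {G : Type*} [PseudoMetricSpace G] (f : G → G) (x y : G) : Prop :=
  ∀ ε > (0 : ℝ), ∀ N : ℕ, ∃ n ≥ N, dist (f^[n] x) (f^[n] y) < ε

/-- The pair `⟨x,y⟩` is asymptotic. -/
def Asymptotic {G : Type*} [PseudoMetricSpace G] (f : G → G) (x y : G) : Prop :=
  Filter.Tendsto (fun n => dist (f^[n] x) (f^[n] y)) Filter.atTop (nhds 0)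

/-- A scrambled pair is proximal but not asymptotic. -/
def ScrambledPair {G : Type*} [PseudoMetricSpace G] (f : G → G) (x y : G) : Prop :=
  Proximal f x y ∧ ¬ Asymptotic f x y

/-- Li–Yorke chaos: existence of an uncountable scrambled set. -/
def LiYorkeChaotic {G : Type*} [PseudoMetricSpace G] (f : G → G) : Prop :=
  ∃ S : Set G, ¬ S.Countable ∧ ∀ x ∈ S, ∀ y ∈ S, x ≠ y → ScrambledPair f x y

/-- `I ⊆ ℕ` is an independence set for the pair of sets `{A, B}`. -/
def IsIndepSet {G : Type*} (f : G → G) (A B : Set G) (I : Set ℕ) : Prop :=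
  ∀ J : Finset ℕ, ↑J ⊆ I → J.Nonempty → ∀ S : ℕ → Bool,
    (⋂ i ∈ J, f^[i] ⁻¹' (if S i then A else B)).Nonempty

/-- An IN-pair: every pair of neighborhoods has arbitrarily large finite
independence sets. -/
def IsINPair {G : Type*} [TopologicalSpace G] (f : G → G) (x y : G) : Prop :=
  ∀ U V : Set G, U ∈ nhds x → V ∈ nhds y →
    ∀ n : ℕ, ∃ I : Finset ℕ, n ≤ I.card ∧ IsIndepSet f U V ↑I

/-- An IT-pair: every pair of neighborhoods has an infinite independence set. -/
def IsITPair {G : Type*} [TopologicalSpace G] (f : G → G) (x y : G) : Prop :=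
  ∀ U V : Set G, U ∈ nhds x → V ∈ nhds y →
    ∃ I : Set ℕ, I.Infinite ∧ IsIndepSet f U V I

/-- The set of periodic points of `f`. -/
def PerPts {G : Type*} (f : G → G) : Set G :=
  {p | ∃ n ≥ 1, f^[n] p = p}

/-- A continuous self-map of a compact connected subset of an arc has a fixed point. -/
theorem exists_fixedPt_of_subset_range {X : Type*} [TopologicalSpace X] [T2Space X]
    {φ : Set.Icc (0:ℝ) 1 → X} (hφ : Continuous φ) (hinj : Function.Injective φ)
    {C : Set X} (hC : IsCompact C) (hconn : IsConnected C) (hsub : C ⊆ range φ)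
    {g : X → X} (hg : Continuous g) (hmaps : MapsTo g C C) : ∃ c ∈ C, g c = c := by
  have hemb : IsClosedEmbedding φ := hφ.isClosedEmbedding hinj
  have hright : ∀ c ∈ C, φ (Function.invFun φ c) = c := fun c hc =>
    Function.invFun_eq (hsub hc)
  have hcont : ContinuousOn (Function.invFun φ) C := by
    rw [hemb.isInducing.continuousOn_iff]
    exact continuousOn_id.congr hright
  obtain ⟨a, ha, hmin⟩ := hC.exists_isMinOn hconn.nonempty hcont
  obtain ⟨b, hb, hmax⟩ := hC.exists_isMaxOn hconn.nonempty hcont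
  obtain ⟨c, hc, hceq⟩ := hconn.isPreconnected.intermediate_value₂ ha hb hcont
    (hcont.comp hg.continuousOn hmaps) (hmin (hmaps ha)) (hmax (hmaps hb))
  refine ⟨c, hc, ?_⟩
  exact (hright _ (hmaps hc)).symm.trans ((congrArg φ hceq.symm).trans (hright c hc))

/-- A connected subset of an arc avoiding a suitable finite set has small diameter. -/
theorem exists_finite_dist_lt_of_subset_range {X : Type*} [MetricSpace X]
    {φ : Set.Icc (0:ℝ) 1 → X} (hφ : Continuous φ) (hinj : Function.Injective φ)
    {ε : ℝ} (hε : 0 < ε) :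
    ∃ V : Set X, V.Finite ∧ ∀ C : Set X, IsPreconnected C → C ⊆ range φ → Disjoint C V →
      ∀ x ∈ C, ∀ y ∈ C, dist x y < ε := by
  have hemb : IsClosedEmbedding φ := hφ.isClosedEmbedding hinj
  obtain ⟨δ, hδ, hunif⟩ := Metric.uniformContinuous_iff.1
    (CompactSpace.uniformContinuous_of_continuous hφ) ε hε
  obtain ⟨T, -, hT, hcover⟩ := (isCompact_univ (X := Set.Icc (0:ℝ) 1)).finite_cover_balls
    (half_pos hδ)
  refine ⟨φ '' T, hT.image φ, fun C hC hsub hdisj => ?_⟩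
  have hpre : (φ ⁻¹' C).OrdConnected := by
    refine IsPreconnected.ordConnected ?_
    rw [← hemb.isInducing.isPreconnected_image, image_preimage_eq_of_subset hsub]
    exact hC
  have key : ∀ s t : Set.Icc (0:ℝ) 1, φ s ∈ C → φ t ∈ C → s ≤ t → dist s t < δ := by
    intro s t hs ht hst
    by_contra! hge
    have hst' : (s : ℝ) ≤ t := hst
    rw [Subtype.dist_eq, Real.dist_eq, abs_sub_comm, abs_of_nonneg (by linarith)] at hge
    have hmid : ((s : ℝ) + t) / 2 ∈ Set.Icc (0:ℝ) 1 :=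
      ⟨by linarith [s.2.1, t.2.1], by linarith [s.2.2, t.2.2]⟩
    obtain ⟨q, hq, hdist⟩ := mem_iUnion₂.1 (hcover (mem_univ ⟨_, hmid⟩))
    rw [Metric.mem_ball, Subtype.dist_eq, Real.dist_eq, abs_lt] at hdist
    refine hdisj.le_bot ⟨hpre.out hs ht ⟨?_, ?_⟩, mem_image_of_mem φ hq⟩
    · change (s : ℝ) ≤ q
      dsimp only at hdist
      linarith [hdist.2]
    · change (q : ℝ) ≤ t
      dsimp only at hdist
      linarith [hdist.1]
  intro x hx y hy
  obtain ⟨s, rfl⟩ := hsub hx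
  obtain ⟨t, rfl⟩ := hsub hy
  apply hunif
  rcases le_total s t with h | h
  · exact key s t hx hy h
  · rw [dist_comm]
    exact key t s hy hx h

/-- In a topological graph, a compact connected set avoiding a suitable finite set has small
diameter and the fixed point property. -/
theorem IsTopGraph.exists_finite_small_fixedPt {G : Type*} [MetricSpace G] (hG : IsTopGraph G)
    {ε : ℝ} (hε : 0 < ε) :
    ∃ V : Set G, V.Finite ∧ ∀ C : Set G, IsCompact C → IsConnected C → Disjoint C V →
      (∀ x ∈ C, ∀ y ∈ C, dist x y < ε) ∧
      ∀ g : G → G, Continuous g → MapsTo g C C → ∃ c ∈ C, g c = c := by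
  obtain ⟨-, -, n, A, a, b, harc, hcover, hinter⟩ := hG
  choose φ hφ hinj hrange _ _ using harc
  choose V hV hsmall using fun i => exists_finite_dist_lt_of_subset_range (hφ i) (hinj i) hε
  have hclosed : ∀ i, IsClosed (A i) := fun i => by
    rw [← hrange i]
    exact (isCompact_range (hφ i)).isClosed
  refine ⟨(⋃ i, V i) ∪ ⋃ i, {a i, b i}, (finite_iUnion hV).union
    (finite_iUnion fun i => toFinite _), fun C hC hconn hdisj => ?_⟩
  rw [disjoint_union_right, disjoint_iUnion_right, disjoint_iUnion_right] at hdisj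
  obtain ⟨c, hc⟩ := hconn.nonempty
  obtain ⟨i, hci⟩ := mem_iUnion.1 (hcover.symm ▸ mem_univ c : c ∈ ⋃ i, A i)
  have hsub : C ⊆ range (φ i) := by
    rw [hrange i]
    intro d hd
    by_contra hdi
    have hother : ∀ y, y ∉ A i → y ∈ ⋃ j ∈ ({i}ᶜ : Set (Fin n)), A j := by
      intro y hy
      obtain ⟨j, hyj⟩ := mem_iUnion.1 (hcover.symm ▸ mem_univ y : y ∈ ⋃ i, A i)
      exact mem_iUnion₂.2 ⟨j, fun h => hy (by rwa [mem_singleton_iff.1 h] at hyj), hyj⟩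
    obtain ⟨y, hyC, hyi, hy⟩ := isPreconnected_closed_iff.1 hconn.isPreconnected (A i)
      (⋃ j ∈ ({i}ᶜ : Set (Fin n)), A j) (hclosed i)
      ((toFinite _).isClosed_biUnion fun j _ => hclosed j)
      (fun y _ => or_iff_not_imp_left.2 (hother y)) ⟨c, hc, hci⟩ ⟨d, hd, hother d hdi⟩
    obtain ⟨j, hji, hyj⟩ := mem_iUnion₂.1 hy
    rcases hinter i j (Ne.symm hji) with h | ⟨p, hp, hpi, -⟩
    · exact (h ▸ (⟨hyi, hyj⟩ : y ∈ A i ∩ A j) : y ∈ (∅ : Set G))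
    · have hyp : y = p := (hp ▸ (⟨hyi, hyj⟩ : y ∈ A i ∩ A j) : y ∈ ({p} : Set G))
      exact (hdisj.2 i).le_bot ⟨hyC, hyp ▸ hpi⟩
  exact ⟨hsmall i C hconn.isPreconnected hsub (hdisj.1 i), fun g hg hmaps =>
    exists_fixedPt_of_subset_range (hφ i) (hinj i) hC hconn hsub hg hmaps⟩

theorem isClosed_omegaSet {G : Type*} [TopologicalSpace G] (f : G → G) (x : G) :
    IsClosed (omegaSet f x) :=
  isClosed_iInter fun _ => isClosed_closure

theorem omegaSet_nonempty {G : Type*} [TopologicalSpace G] [CompactSpace G] (f : G → G) (x : G) :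
    (omegaSet f x).Nonempty :=
  IsCompact.nonempty_iInter_of_sequence_nonempty_isCompact_isClosed _
    (fun n => closure_mono (image_mono (Ici_subset_Ici.2 n.le_succ)))
    (fun n => ⟨f^[n] x, subset_closure (mem_image_of_mem _ self_mem_Ici)⟩)
    isClosed_closure.isCompact (fun _ => isClosed_closure)

theorem mapsTo_omegaSet {G : Type*} [TopologicalSpace G] {f : G → G} (hf : Continuous f) (x : G) :
    MapsTo f (omegaSet f x) (omegaSet f x) := by
  intro y hy
  refine mem_iInter.2 fun n => ?_
  refine closure_mono ?_ (image_closure_subset_closure_image hf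
    (mem_image_of_mem f (mem_iInter.1 hy n)))
  rintro _ ⟨_, ⟨m, hm, rfl⟩, rfl⟩
  exact ⟨m + 1, le_trans hm m.le_succ, Function.iterate_succ_apply' f m x⟩

theorem mapsTo_perPts {G : Type*} (f : G → G) : MapsTo f (PerPts f) (PerPts f) := by
  rintro p ⟨n, hn, hp⟩
  exact ⟨n, hn, by rw [← Function.iterate_succ_apply, Function.iterate_succ_apply', hp]⟩

/-- A nonempty closed forward invariant set in a compact space contains a minimal one. -/
theorem exists_minimal_closed_mapsTo {X : Type*} [TopologicalSpace X] [CompactSpace X]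
    (f : X → X) {Z : Set X} (hZ : IsClosed Z) (hne : Z.Nonempty) (hmaps : MapsTo f Z Z) :
    ∃ M ⊆ Z, Minimal (fun N : Set X => IsClosed N ∧ N.Nonempty ∧ MapsTo f N N) M := by
  refine zorn_superset_nonempty {N : Set X | IsClosed N ∧ N.Nonempty ∧ MapsTo f N N} ?_ Z
    ⟨hZ, hne, hmaps⟩
  intro c hc hchain hcne
  refine ⟨⋂₀ c, ⟨isClosed_sInter fun N hN => (hc hN).1, ?_, ?_⟩,
    fun N hN => sInter_subset_of_mem hN⟩
  · have : Nonempty c := hcne.to_subtype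
    exact IsCompact.nonempty_sInter_of_directed_nonempty_isCompact_isClosed
      (fun A hA B hB => (hchain.total hA hB).elim (fun h => ⟨A, hA, Subset.rfl, h⟩)
        fun h => ⟨B, hB, h, Subset.rfl⟩) (fun N hN => (hc hN).2.1)
      (fun N hN => (hc hN).1.isCompact) (fun N hN => (hc hN).1)
  · exact fun y hy N hN => (hc hN).2.2 (hy N hN)

/-- A nonempty closed forward invariant subset of a compact metric space without periodic points
is uncountable. -/
theorem not_countable_of_disjoint_perPts {X : Type*} [MetricSpace X] [CompactSpace X]
    {f : X → X} (hf : Continuous f) {Z : Set X} (hZ : IsClosed Z) (hne : Z.Nonempty)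
    (hmaps : MapsTo f Z Z) (hper : Disjoint Z (PerPts f)) : ¬ Z.Countable := by
  intro hcount
  obtain ⟨M, hMZ, ⟨hM, hMne, hMmaps⟩, hmin⟩ := exists_minimal_closed_mapsTo f hZ hne hmaps
  have : Countable M := (hcount.mono hMZ).to_subtype
  have : Nonempty M := hMne.to_subtype
  have : CompactSpace M := isCompact_iff_compactSpace.1 hM.isCompact
  obtain ⟨p, hp⟩ := nonempty_interior_of_iUnion_of_closed (fun p : M => isClosed_singleton (x := p))
    (iUnion_of_singleton M)
  have hopen : IsOpen ({p} : Set M) := by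
    rw [← interior_eq_iff_isOpen]
    exact hp.subset_singleton_iff.1 interior_subset
  obtain ⟨U, hU, hUp⟩ := isOpen_induced_iff.1 hopen
  have hiter : ∀ m, f^[m] p ∈ M := fun m => hMmaps.iterate m p.2
  have hsub : closure (range fun m => f^[m + 1] (p : X)) ⊆ M :=
    closure_minimal (range_subset_iff.2 fun m => hiter _) hM
  have hpcl : (p : X) ∈ closure (range fun m => f^[m + 1] (p : X)) := by
    refine hmin ⟨isClosed_closure, (range_nonempty _).closure, ?_⟩ hsub p.2
    refine MapsTo.closure ?_ hf
    rintro _ ⟨m, rfl⟩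
    exact ⟨m + 1, Function.iterate_succ_apply' f (m + 1) p⟩
  have hpU : (p : X) ∈ U := (hUp.symm ▸ mem_singleton p : p ∈ Subtype.val ⁻¹' U)
  obtain ⟨_, hyU, m, rfl⟩ := mem_closure_iff.1 hpcl U hU hpU
  have heq : (⟨_, hiter (m + 1)⟩ : M) = p :=
    (hUp ▸ hyU : (⟨_, hiter (m + 1)⟩ : M) ∈ ({p} : Set M))
  exact hper.le_bot ⟨hMZ p.2, m + 1, m.succ_pos, congrArg Subtype.val heq⟩

theorem IsPeriodicSubgraph.image_iterate_image {G : Type*} [TopologicalSpace G] {f : G → G}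
    {K : Set G} {k : ℕ} (hK : IsPeriodicSubgraph f K k) (j : ℕ) :
    f^[k] '' (f^[j] '' K) = f^[j] '' K := by
  rw [← image_comp, ← Function.iterate_add, add_comm, Function.iterate_add, image_comp, hK.2.2.1]

theorem IsPeriodicSubgraph.image_iterate_mod {G : Type*} [TopologicalSpace G] {f : G → G}
    {K : Set G} {k : ℕ} (hK : IsPeriodicSubgraph f K k) (j : ℕ) :
    f^[j % k] '' K = f^[j] '' K := by
  have h : ∀ q, f^[k * q] '' K = K := by
    intro q
    induction q with
    | zero => simp
    | succ q ih => rw [Nat.mul_succ, Function.iterate_add, image_comp, hK.2.2.1, ih]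
  conv_rhs => rw [← Nat.mod_add_div j k, Function.iterate_add, image_comp, h]

theorem IsSolenoid.disjoint_perPts {G : Type*} [TopologicalSpace G] {f : G → G} {W : Set G}
    (hW : IsSolenoid f W) : Disjoint W (PerPts f) := by
  refine disjoint_left.2 ?_
  rintro p hp ⟨m, hm, hpm⟩
  obtain ⟨X, k, hmk, ⟨K, hK, rfl⟩, hsub⟩ := hW.2 (m + 1)
  obtain ⟨i, hi, hpi⟩ := mem_iUnion₂.1 (hsub hp)
  have hik : i < k := Finset.mem_range.1 hi
  have hp' : p ∈ f^[(i + m) % k] '' K := by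
    rw [hK.image_iterate_mod, add_comm, Function.iterate_add, image_comp]
    exact ⟨p, hpi, hpm⟩
  refine (hK.2.2.2 i ((i + m) % k) hik (Nat.mod_lt _ hK.2.1) fun h => ?_).le_bot ⟨hpi, hp'⟩
  have hmod : (i + m) % k = (i + 0) % k := by rw [← h, add_zero, Nat.mod_eq_of_lt hik]
  have hdvd : m % k = 0 % k := Nat.ModEq.add_left_cancel' i hmod
  rw [Nat.mod_eq_of_lt (by omega), Nat.zero_mod] at hdvd
  omega

/-- A solenoidal forward invariant set comes arbitrarily close to the periodic points. -/
theorem IsSolenoid.exists_dist_perPts_lt {G : Type*} [MetricSpace G] (hG : IsTopGraph G)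
    {f : G → G} (hf : Continuous f) {W : Set G} (hW : IsSolenoid f W) (hmaps : MapsTo f W W)
    {ε : ℝ} (hε : 0 < ε) : ∃ w ∈ W, ∃ p ∈ PerPts f, dist w p < ε := by
  have : CompactSpace G := hG.1
  obtain ⟨V, hV, hsmall⟩ := hG.exists_finite_small_fixedPt hε
  obtain ⟨X, k, hcard, ⟨K, hK, rfl⟩, hsub⟩ := hW.2 (hV.toFinset.card + 1)
  obtain ⟨j, -, hdisj⟩ : ∃ j < k, Disjoint (f^[j] '' K) V := by
    by_contra! hall
    have hmeet : ∀ j : Fin k, ∃ v, v ∈ f^[j] '' K ∧ v ∈ V := fun j =>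
      not_disjoint_iff.1 (hall j j.2)
    choose v hvK hvV using hmeet
    have hle := Finset.card_le_card_of_injOn (s := Finset.univ) (t := hV.toFinset) v
      (fun j _ => hV.mem_toFinset.2 (hvV j)) (fun i _ j _ hij => by
        by_contra hne
        exact (hK.2.2.2 i j i.2 j.2 (Fin.val_injective.ne hne)).le_bot ⟨hvK i, hij ▸ hvK j⟩)
    rw [Finset.card_univ, Fintype.card_fin] at hle
    omega
  have hcont : ∀ m, Continuous f^[m] := fun m => hf.iterate m
  obtain ⟨hdist, hfix⟩ := hsmall _ (hK.1.1.isCompact.image (hcont j))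
    (hK.1.2.1.image _ (hcont j).continuousOn) hdisj
  obtain ⟨p, hp, hpk⟩ := hfix f^[k] (hcont k)
    (mapsTo_iff_image_subset.2 (hK.image_iterate_image j).subset)
  obtain ⟨w, hw⟩ := hW.1.nonempty
  obtain ⟨i, hi, hwi⟩ := mem_iUnion₂.1 (hsub hw)
  have hik : i < k := Finset.mem_range.1 hi
  refine ⟨f^[j + (k - i)] w, hmaps.iterate _ hw, p, ⟨k, hK.2.1, hpk⟩, hdist _ ?_ _ hp⟩
  rw [← hK.image_iterate_image j, ← image_comp, ← Function.iterate_add,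
    show k + j = j + (k - i) + i by omega, Function.iterate_add f _ i, image_comp]
  exact mem_image_of_mem _ hwi

/-- If `ω_f(x)` is a solenoid, then `ω_f(x) ∩ cl(Per(f))` is uncountable. -/
theorem solenoid_inter_closure_perPts_uncountable {G : Type*} [MetricSpace G]
    (hG : IsTopGraph G) (f : G → G) (hf : Continuous f) (x : G)
    (hsol : IsSolenoid f (omegaSet f x)) :
    ¬ (omegaSet f x ∩ closure (PerPts f)).Countable := by
  have : CompactSpace G := hG.1
  have hW := isClosed_omegaSet f x
  have hmaps := mapsTo_omegaSet hf x
  refine not_countable_of_disjoint_perPts hf (hW.inter isClosed_closure) ?_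
    (hmaps.inter_inter ((mapsTo_perPts f).closure hf))
    (hsol.disjoint_perPts.mono_left inter_subset_left)
  by_contra hempty
  obtain ⟨ε, hε, hdisj⟩ := (disjoint_iff_inter_eq_empty.2
    (not_nonempty_iff_eq_empty.1 hempty)).exists_thickenings hW.isCompact isClosed_closure
  obtain ⟨w, hw, p, hp, hwp⟩ := hsol.exists_dist_perPts_lt hG hf hmaps hε
  exact hdisj.le_bot ⟨Metric.mem_thickening_iff.2 ⟨w, hw, by rwa [dist_comm]⟩,
    Metric.self_subset_thickening hε _ (subset_closure hp)⟩
end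

section
/- Let f : G → G be a graph map and x ∈ G such that ω_f(x) is infinite and is not a solenoid. Suppose X is a cycle of graphs containing ω_f(x) which is contained in every cycle of graphs containing ω_f(x), and suppose X contains no periodic point of f. Then ω_f(x) ∩ cl(Per(f)) is finite. -/
open Set Filter Topology

/-- If an arc meets the rest of a space only in its endpoints and the rest is closed, then the
image of an open subinterval under a parametrization of the arc is open. -/
theorem isOpen_image_Ioo_of_inter_subset_ends {X : Type*} [TopologicalSpace X] [T2Space X]
    {φ : Set.Icc (0:ℝ) 1 → X} (hφ : Continuous φ) (hinj : Function.Injective φ) {B : Set X}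
    (hB : IsClosed B) (hcov : Set.range φ ∪ B = Set.univ)
    (hends : Set.range φ ∩ B ⊆ {φ ⊥, φ ⊤}) (u v : Set.Icc (0:ℝ) 1) :
    IsOpen (φ '' Set.Ioo u v) := by
  have hc : IsClosed (φ '' (Set.Ioo u v)ᶜ) := hφ.isClosedMap _ isOpen_Ioo.isClosed_compl
  have heq : φ '' Set.Ioo u v = (φ '' (Set.Ioo u v)ᶜ ∪ B)ᶜ := by
    ext p
    constructor
    · rintro ⟨t, ht, rfl⟩ (⟨s, hs, hst⟩ | hp)
      · exact hs (hinj hst ▸ ht)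
      · rcases hends ⟨⟨t, rfl⟩, hp⟩ with h | h
        · exact not_lt_bot (hinj h ▸ ht.1)
        · exact not_top_lt (hinj h ▸ ht.2)
    · intro hp
      have hp' : p ∈ Set.range φ ∪ B := hcov ▸ Set.mem_univ p
      rcases hp' with ⟨t, rfl⟩ | h
      · by_contra hn
        exact hp (Or.inl ⟨t, fun ht => hn ⟨t, ht, rfl⟩, rfl⟩)
      · exact absurd (Or.inr h) hp
  rw [heq]
  exact (hc.union hB).isOpen_compl

/-- If a connected set meets the image of an interval whose ends are mapped outside it, then it is
contained in that image, provided the image of the open interval is open. -/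
theorem IsPreconnected.subset_image_Ioo {X I : Type*} [TopologicalSpace X] [T2Space X]
    [LinearOrder I] [TopologicalSpace I] [OrderTopology I] [CompactSpace I] {φ : I → X}
    (hφ : Continuous φ) {C : Set X} (hC : IsPreconnected C) {u v t : I}
    (hopen : IsOpen (φ '' Set.Ioo u v)) (hu : φ u ∉ C) (hv : φ v ∉ C)
    (ht : t ∈ Set.Ioo u v) (htC : φ t ∈ C) : C ⊆ φ '' Set.Ioo u v := by
  refine hC.subset_left_of_subset_union hopen (hφ.isClosedMap _ isClosed_Icc).isOpen_compl
    (disjoint_compl_right.mono_left (Set.image_mono Set.Ioo_subset_Icc_self)) ?_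
    ⟨φ t, htC, t, ht, rfl⟩
  intro p hp
  by_contra hn
  simp only [Set.mem_union, Set.mem_compl_iff, not_or, not_not] at hn
  obtain ⟨hn, s, hs, rfl⟩ := hn
  have h1 : u ≠ s := fun h => hu (h ▸ hp)
  have h2 : s ≠ v := fun h => hv (h ▸ hp)
  exact hn ⟨s, ⟨lt_of_le_of_ne hs.1 h1, lt_of_le_of_ne hs.2 h2⟩, rfl⟩

/-- A closed connected set has only finitely many frontier points in the interior of an arc whose
open subintervals are open. -/
theorem finite_frontier_preimage_Ioo {X : Type*} [TopologicalSpace X] [T2Space X]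
    {φ : Set.Icc (0:ℝ) 1 → X} (hφ : Continuous φ) (hinj : Function.Injective φ)
    (hopen : ∀ u v, IsOpen (φ '' Set.Ioo u v)) {C : Set X} (hCc : IsClosed C)
    (hC : IsPreconnected C) : {t ∈ Set.Ioo ⊥ ⊤ | φ t ∈ frontier C}.Finite := by
  have hnear : ∀ t, φ t ∈ frontier C → ∀ u v, t ∈ Set.Ioo u v → ∃ s ∈ Set.Ioo u v, φ s ∉ C := by
    intro t ht u v htuv
    rw [frontier_eq_closure_inter_closure] at ht
    obtain ⟨_, ⟨s, hs, rfl⟩, hsC⟩ := mem_closure_iff.1 ht.2 _ (hopen u v) ⟨t, htuv, rfl⟩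
    exact ⟨s, hs, hsC⟩
  have htrap : ∀ u v t s, φ u ∉ C → φ v ∉ C → t ∈ Set.Ioo u v → φ t ∈ C → φ s ∈ C →
      s ∈ Set.Ioo u v := fun u v t s hu hv ht htC hsC =>
    hinj.mem_set_image.1 (hC.subset_image_Ioo hφ (hopen u v) hu hv ht htC hsC)
  by_contra hinf
  obtain ⟨T, hT, hcard⟩ := Set.Infinite.exists_subset_card_eq hinf 3
  have hmem : ∀ i, T.orderEmbOfFin hcard i ∈ {t ∈ Set.Ioo ⊥ ⊤ | φ t ∈ frontier C} :=
    fun i => hT (T.orderEmbOfFin_mem hcard i)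
  have h01 := (T.orderEmbOfFin hcard).strictMono (show (0 : Fin 3) < 1 by decide)
  have h12 := (T.orderEmbOfFin hcard).strictMono (show (1 : Fin 3) < 2 by decide)
  obtain ⟨m0, f0⟩ := hmem 0
  obtain ⟨-, f1⟩ := hmem 1
  obtain ⟨m2, f2⟩ := hmem 2
  generalize T.orderEmbOfFin hcard 0 = p at *
  generalize T.orderEmbOfFin hcard 1 = q at *
  generalize T.orderEmbOfFin hcard 2 = r at *
  have hpC := hCc.frontier_subset f0
  have hqC := hCc.frontier_subset f1
  have hrC := hCc.frontier_subset f2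
  obtain ⟨u, hu, huC⟩ := hnear q f1 p r ⟨h01, h12⟩
  rcases lt_trichotomy u q with h | rfl | h
  · obtain ⟨w, hw, hwC⟩ := hnear r f2 q ⊤ ⟨h12, m2.2⟩
    exact lt_asymm hu.1 (htrap u w q p huC hwC ⟨h, hw.1⟩ hqC hpC).1
  · exact huC hqC
  · obtain ⟨w, hw, hwC⟩ := hnear p f0 ⊥ q ⟨m0.1, h01⟩
    exact lt_asymm hu.2 (htrap w u q r hwC huC ⟨hw.2, h⟩ hqC hrC).2

/-- Closed connected subsets of a topological graph have finite frontier. -/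
theorem IsTopGraph.finite_frontier {G : Type*} [TopologicalSpace G] [T2Space G]
    (hG : IsTopGraph G) {C : Set G} (hCc : IsClosed C) (hC : IsPreconnected C) :
    (frontier C).Finite := by
  obtain ⟨-, -, n, A, a, b, harc, hcov, hinter⟩ := hG
  choose φ hφ hinj hrange ha hb using harc
  have hAc : ∀ i, IsClosed (A i) := fun i => hrange i ▸ (isCompact_range (hφ i)).isClosed
  have hopen : ∀ i u v, IsOpen (φ i '' Set.Ioo u v) := by
    intro i
    refine isOpen_image_Ioo_of_inter_subset_ends (hφ i) (hinj i)
      (B := ⋃ j ∈ {j | j ≠ i}, A j) ((Set.toFinite _).isClosed_biUnion fun j _ => hAc j) ?_ ?_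
    · refine Set.eq_univ_of_forall fun p => ?_
      obtain ⟨j, hj⟩ := Set.mem_iUnion.1 (hcov ▸ Set.mem_univ p)
      rcases eq_or_ne j i with rfl | hne
      · exact Or.inl (hrange j ▸ hj)
      · exact Or.inr (Set.mem_biUnion hne hj)
    · rintro p ⟨hp, hpB⟩
      obtain ⟨j, hne, hj⟩ := Set.mem_iUnion₂.1 hpB
      rw [hrange] at hp
      rcases hinter i j hne.symm with h | ⟨q, h, hq, -⟩
      · exact absurd (show p ∈ A i ∩ A j from ⟨hp, hj⟩) (h ▸ Set.notMem_empty p)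
      · have hpq : p = q := by
          have : p ∈ A i ∩ A j := ⟨hp, hj⟩
          rwa [h] at this
        rw [hpq]
        rw [← ha i, ← hb i] at hq
        exact hq
  have hfin : (⋃ i, ({φ i ⊥, φ i ⊤} ∪ φ i '' {t ∈ Set.Ioo ⊥ ⊤ | φ i t ∈ frontier C})).Finite :=
    Set.finite_iUnion fun i => (Set.toFinite _).union
      ((finite_frontier_preimage_Ioo (hφ i) (hinj i) (hopen i) hCc hC).image _)
  refine hfin.subset fun p hp => ?_
  obtain ⟨i, hi⟩ := Set.mem_iUnion.1 (hcov ▸ Set.mem_univ p)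
  rw [← hrange i] at hi
  obtain ⟨t, rfl⟩ := hi
  refine Set.mem_iUnion.2 ⟨i, ?_⟩
  rcases eq_or_ne t ⊥ with rfl | h0
  · exact Or.inl (Or.inl rfl)
  rcases eq_or_ne t ⊤ with rfl | h1
  · exact Or.inl (Or.inr rfl)
  exact Or.inr ⟨t, ⟨⟨bot_lt_iff_ne_bot.2 h0, lt_top_iff_ne_top.2 h1⟩, hp⟩, rfl⟩

/-- Let `ω_f(x)` be infinite and not a solenoid. If `X` is a cycle of graphs containing
`ω_f(x)`, contained in every cycle of graphs containing `ω_f(x)`, and containing no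
periodic point, then `ω_f(x) ∩ cl(Per(f))` is finite. -/
theorem omegaSet_inter_closure_perPts_finite {G : Type*} [MetricSpace G]
    (hG : IsTopGraph G) (f : G → G) (hf : Continuous f) (x : G)
    (hinf : (omegaSet f x).Infinite)
    (hnotsol : ¬ IsSolenoid f (omegaSet f x))
    (X : Set G) (k : ℕ) (hX : IsCycleOfGraphs f X k)
    (hsub : omegaSet f x ⊆ X)
    (hmin : ∀ (Y : Set G) (l : ℕ), IsCycleOfGraphs f Y l → omegaSet f x ⊆ Y → X ⊆ Y)
    (hnoper : ∀ p ∈ X, p ∉ PerPts f) :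
    (omegaSet f x ∩ closure (PerPts f)).Finite := by
  obtain ⟨K, ⟨⟨hKc, hKconn, -⟩, -⟩, rfl⟩ := hX
  have : CompactSpace G := hG.1
  have hfin : (⋃ i ∈ Finset.range k, frontier (f^[i] '' K)).Finite :=
    (Finset.range k).finite_toSet.biUnion fun i _ =>
      hG.finite_frontier ((hf.iterate i).isClosedMap _ hKc)
        (hKconn.isPreconnected.image _ (hf.iterate i).continuousOn)
  refine hfin.subset fun p ⟨hpω, hpc⟩ => ?_
  obtain ⟨i, hi, hp⟩ := Set.mem_iUnion₂.1 (hsub hpω)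
  refine Set.mem_biUnion hi ?_
  rw [frontier_eq_closure_inter_closure]
  exact ⟨subset_closure hp, closure_mono
    (fun q hq hqK => hnoper q (Set.mem_biUnion hi hqK) hq) hpc⟩
end

section
/- Let f : G → G be a graph map and let x, y ∈ ω(f) be two distinct points. If there exists a sequence (J_n) of periodic subgraphs with periods (m_n) such that J_{n+1} ⊆ J_n, m_n → ∞, and x, y ∈ J_n for all n, then: (1) there exists a point z ∈ G such that x, y ∈ ω_f(z); (2) ω_f(x), ω_f(y) and ω_f(z) are solenoids; (3) x and y are non-separable. -/
open Set Filter Topology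

/-- A decomposition of `X` into finitely many arcs, seen as a finite set `V` of vertices
and finitely many pairwise disjoint open edges. -/
structure EdgeDecomposition (X : Type*) [TopologicalSpace X] where
  /-- The vertices. -/
  V : Set X
  /-- The number of edges. -/
  n : ℕ
  /-- The parametrizations of the edges. -/
  φ : Fin n → Set.Icc (0:ℝ) 1 → X
  finite_V : V.Finite
  continuous_φ : ∀ i, Continuous (φ i)
  injective_φ : ∀ i, Function.Injective (φ i)
  exists_eq : ∀ p, ∃ i t, φ i t = p
  notMem_V : ∀ i t, t ∈ Ioo (0 : Set.Icc (0:ℝ) 1) 1 → φ i t ∉ V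
  mem_Ioo : ∀ i t, φ i t ∉ V → t ∈ Ioo (0 : Set.Icc (0:ℝ) 1) 1
  isOpen_edge : ∀ i, IsOpen (φ i '' Ioo 0 1)
  eq_of_eq : ∀ i j t s, φ i t = φ j s → φ i t ∉ V → i = j

theorem IsTopGraph.nonempty_edgeDecomposition {X : Type*} [TopologicalSpace X] [T2Space X]
    (h : IsTopGraph X) : Nonempty (EdgeDecomposition X) := by
  obtain ⟨-, -, n, A, a, b, hA, hU, hI⟩ := h
  choose φ hc hinj hr h0 h1 using hA
  have hcl : ∀ i, IsClosed (A i) := fun i => by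
    rw [← hr i]; exact (isCompact_range (hc i)).isClosed
  have h0' : ∀ i, φ i 0 = a i := h0
  have h1' : ∀ i, φ i 1 = b i := h1
  have hIoo : ∀ i t, φ i t ≠ a i → φ i t ≠ b i → t ∈ Ioo (0 : Set.Icc (0:ℝ) 1) 1 := by
    intro i t hta htb
    refine ⟨lt_of_le_of_ne t.2.1 ?_, lt_of_le_of_ne t.2.2 ?_⟩
    · intro e
      exact hta (by rw [← h0' i, ← e])
    · intro e
      exact htb (by rw [← h1' i, ← e])
  have hne : ∀ i t, t ∈ Ioo (0 : Set.Icc (0:ℝ) 1) 1 → φ i t ≠ a i ∧ φ i t ≠ b i := by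
    intro i t ht
    rw [← h0' i, ← h1' i, (hinj i).ne_iff, (hinj i).ne_iff]
    exact ⟨ht.1.ne', ht.2.ne⟩
  have hmem : ∀ i t, φ i t ∈ A i := fun i t => by rw [← hr i]; exact mem_range_self t
  have hcommon : ∀ i j p, i ≠ j → p ∈ A i → p ∈ A j →
      (p = a i ∨ p = b i) ∧ (p = a j ∨ p = b j) := by
    intro i j p hij hi hj
    rcases hI i j hij with h | ⟨q, hq, hqi, hqj⟩
    · exact absurd (show p ∈ A i ∩ A j from ⟨hi, hj⟩) (by simp [h])
    · have : p ∈ A i ∩ A j := ⟨hi, hj⟩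
      rw [hq, mem_singleton_iff] at this
      subst this
      exact ⟨hqi, hqj⟩
  have haA : ∀ i, a i ∈ A i := fun i => by rw [← h0' i]; exact hmem i 0
  have hbA : ∀ i, b i ∈ A i := fun i => by rw [← h1' i]; exact hmem i 1
  refine ⟨⟨range a ∪ range b, n, φ, (finite_range a).union (finite_range b), hc, hinj,
    ?_, ?_, ?_, ?_, ?_⟩⟩
  · intro p
    have : p ∈ ⋃ i, A i := by rw [hU]; trivial
    obtain ⟨i, hi⟩ := mem_iUnion.1 this
    rw [← hr i] at hi
    obtain ⟨t, ht⟩ := hi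
    exact ⟨i, t, ht⟩
  · intro i t ht hV
    obtain ⟨hta, htb⟩ := hne i t ht
    rcases hV with ⟨j, hj⟩ | ⟨j, hj⟩
    · rcases eq_or_ne i j with rfl | hij
      · exact hta hj.symm
      · exact (hcommon i j _ hij (hmem i t) (hj ▸ haA j)).1.elim hta htb
    · rcases eq_or_ne i j with rfl | hij
      · exact htb hj.symm
      · exact (hcommon i j _ hij (hmem i t) (hj ▸ hbA j)).1.elim hta htb
  · intro i t ht
    exact hIoo i t (fun e => ht (Or.inl ⟨i, e.symm⟩)) (fun e => ht (Or.inr ⟨i, e.symm⟩))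
  · intro i
    have : φ i '' Ioo 0 1 = ((⋃ j ∈ {j | j ≠ i}, A j) ∪ {a i, b i})ᶜ := by
      ext p
      simp only [mem_image, mem_compl_iff, mem_union, mem_iUnion, mem_ofPred_eq, mem_insert_iff,
        mem_singleton_iff, not_or, not_exists]
      constructor
      · rintro ⟨t, ht, rfl⟩
        obtain ⟨hta, htb⟩ := hne i t ht
        refine ⟨fun j hj hA => ?_, hta, htb⟩
        exact (hcommon j i _ hj hA (hmem i t)).2.elim hta htb
      · rintro ⟨hj, hpa, hpb⟩
        have : p ∈ ⋃ i, A i := by rw [hU]; trivial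
        obtain ⟨j, hpj⟩ := mem_iUnion.1 this
        have hji : j = i := by
          by_contra hne
          exact hj j hne hpj
        subst hji
        rw [← hr j] at hpj
        obtain ⟨t, rfl⟩ := hpj
        exact ⟨t, hIoo j t hpa hpb, rfl⟩
    rw [this]
    exact (((toFinite _).isClosed_biUnion fun j _ => hcl j).union
      (toFinite _).isClosed).isOpen_compl
  · intro i j t s hts hV
    by_contra hij
    rcases (hcommon i j _ hij (hmem i t) (hts ▸ hmem j s)).1 with h | h
    · exact hV (Or.inl ⟨i, h.symm⟩)
    · exact hV (Or.inr ⟨i, h.symm⟩)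

namespace EdgeDecomposition

variable {X : Type*} [TopologicalSpace X]

theorem isOpen_image_Ioo [T2Space X] (D : EdgeDecomposition X) (i : Fin D.n)
    (u v : Set.Icc (0:ℝ) 1) : IsOpen (D.φ i '' Ioo u v) := by
  have hemb := (D.continuous_φ i).isClosedEmbedding (D.injective_φ i)
  have : D.φ i '' Ioo u v = D.φ i '' Ioo 0 1 ∩ (D.φ i '' (Ioo u v)ᶜ)ᶜ := by
    ext p
    constructor
    · rintro ⟨t, ht, rfl⟩
      refine ⟨⟨t, ⟨lt_of_le_of_lt u.2.1 ht.1, lt_of_lt_of_le ht.2 v.2.2⟩, rfl⟩, ?_⟩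
      rintro ⟨s, hs, hst⟩
      exact hs (D.injective_φ i hst ▸ ht)
    · rintro ⟨⟨t, ht, rfl⟩, h⟩
      refine ⟨t, ?_, rfl⟩
      by_contra hn
      exact h ⟨t, hn, rfl⟩
  rw [this]
  exact (D.isOpen_edge i).inter
    (hemb.isClosedMap _ isOpen_Ioo.isClosed_compl).isOpen_compl

theorem locallyConnectedSpace [T2Space X] (D : EdgeDecomposition X) :
    LocallyConnectedSpace X := by
  have : LocallyConnectedSpace (Set.Icc (0:ℝ) 1) :=
    (isQuotientMap_projIcc (h := zero_le_one (α := ℝ))).isCoinducing.locallyConnectedSpace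
  let F : Fin D.n × Set.Icc (0:ℝ) 1 → X := fun q => D.φ q.1 q.2
  have hF : Continuous F := continuous_prod_of_discrete_left.2 D.continuous_φ
  have hs : Function.Surjective F := fun p => by
    obtain ⟨i, t, h⟩ := D.exists_eq p
    exact ⟨(i, t), h⟩
  exact (hF.isClosedMap.isQuotientMap hF hs).isCoinducing.locallyConnectedSpace

/-- A closed connected subset of a graph has finite boundary. -/
theorem finite_frontier [T2Space X] (D : EdgeDecomposition X) {I : Set X}
    (hI : IsClosed I) (hc : IsPreconnected I) : (frontier I).Finite := by
  have key : ∀ i, (D.φ i ⁻¹' frontier I).Finite := by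
    intro i
    by_contra hinf
    obtain ⟨T, hT, hcard⟩ := Set.Infinite.exists_subset_card_eq hinf 5
    let e := T.orderEmbOfFin hcard
    have hmem : ∀ k, D.φ i (e k) ∈ frontier I := fun k => hT (T.orderEmbOfFin_mem hcard k)
    have gap : ∀ k l m : Fin 5, k < l → l < m → ∃ u ∈ Ioo (e k) (e m), D.φ i u ∉ I := by
      intro k l m hkl hlm
      by_contra! hsub
      have h1 : D.φ i '' Ioo (e k) (e m) ⊆ I := by
        rintro _ ⟨u, hu, rfl⟩; exact hsub u hu
      have h2 : D.φ i (e l) ∈ interior I :=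
        interior_maximal h1 (D.isOpen_image_Ioo i _ _)
          ⟨e l, ⟨e.strictMono hkl, e.strictMono hlm⟩, rfl⟩
      exact (hmem l).2 h2
    obtain ⟨u, hu, huI⟩ := gap 0 1 2 (by decide) (by decide)
    obtain ⟨v, hv, hvI⟩ := gap 2 3 4 (by decide) (by decide)
    have hW : IsOpen (D.φ i '' Ioo u v) := D.isOpen_image_Ioo i u v
    have hC : IsOpen (D.φ i '' Icc u v)ᶜ :=
      (isCompact_Icc.image (D.continuous_φ i)).isClosed.isOpen_compl
    have hsub : I ⊆ D.φ i '' Ioo u v := by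
      refine hc.subset_left_of_subset_union hW hC ?_ ?_ ?_
      · exact disjoint_compl_right.mono_left (image_mono Ioo_subset_Icc_self)
      · intro p hp
        by_cases h : p ∈ D.φ i '' Icc u v
        · obtain ⟨t, ht, rfl⟩ := h
          refine Or.inl ⟨t, ⟨lt_of_le_of_ne ht.1 ?_, lt_of_le_of_ne ht.2 ?_⟩, rfl⟩
          · rintro rfl; exact huI hp
          · rintro rfl; exact hvI hp
        · exact Or.inr h
      · exact ⟨D.φ i (e 2), hI.frontier_subset (hmem 2), e 2, ⟨hu.2, hv.1⟩, rfl⟩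
    obtain ⟨t, ht, hte⟩ := hsub (hI.frontier_subset (hmem 0))
    have := D.injective_φ i hte
    subst this
    exact lt_asymm ht.1 hu.1
  have : frontier I ⊆ ⋃ i, D.φ i '' (D.φ i ⁻¹' frontier I) := by
    intro p hp
    obtain ⟨i, t, rfl⟩ := D.exists_eq p
    exact mem_iUnion.2 ⟨i, t, hp, rfl⟩
  exact (finite_iUnion fun i => (key i).image _).subset this

/-- Neighbourhoods with finite boundary form a basis. -/
theorem exists_nhds_finite_frontier [T2Space X] [CompactSpace X] (D : EdgeDecomposition X)
    {p : X} {U : Set X} (hU : U ∈ 𝓝 p) : ∃ N ∈ 𝓝 p, N ⊆ U ∧ (frontier N).Finite := by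
  have := D.locallyConnectedSpace
  obtain ⟨C, ⟨hC, hCc⟩, hCU⟩ := (closed_nhds_basis p).mem_iff.1 hU
  obtain ⟨W, ⟨hWo, hpW, hW⟩, hWC⟩ :=
    (LocallyConnectedSpace.open_connected_basis p).mem_iff.1 hC
  exact ⟨closure W, mem_of_superset (hWo.mem_nhds hpW) subset_closure,
    (closure_minimal hWC hCc).trans hCU,
    D.finite_frontier isClosed_closure hW.isPreconnected.closure⟩

/-- A connected set without vertices lies in a single edge. -/
theorem exists_subset_edge (D : EdgeDecomposition X) {L : Set X} (hL : IsPreconnected L)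
    (hne : L.Nonempty) (hV : ∀ p ∈ L, p ∉ D.V) : ∃ i, L ⊆ D.φ i '' Ioo 0 1 := by
  obtain ⟨p, hp⟩ := hne
  obtain ⟨i, t, rfl⟩ := D.exists_eq p
  have ht := D.mem_Ioo i t (hV _ hp)
  refine ⟨i, hL.subset_left_of_subset_union (D.isOpen_edge i)
    (isOpen_biUnion fun j (_ : j ∈ {j | j ≠ i}) => D.isOpen_edge j) ?_ ?_ ⟨_, hp, t, ht, rfl⟩⟩
  · rw [Set.disjoint_left]
    rintro _ ⟨s, hs, rfl⟩ h
    obtain ⟨j, hj, r, hr, hrs⟩ := mem_iUnion₂.1 h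
    exact hj (D.eq_of_eq i j s r hrs.symm (D.notMem_V i s hs)).symm
  · intro q hq
    obtain ⟨j, s, rfl⟩ := D.exists_eq q
    have hs := D.mem_Ioo j s (hV _ hq)
    rcases eq_or_ne j i with rfl | hji
    · exact Or.inl ⟨s, hs, rfl⟩
    · exact Or.inr (mem_iUnion₂.2 ⟨j, hji, s, hs, rfl⟩)

theorem image_Ioo_subset [CompactSpace X] [T2Space X] (D : EdgeDecomposition X) {L : Set X}
    (hL : IsPreconnected L) {i : Fin D.n} (hLi : L ⊆ range (D.φ i)) {s t : Set.Icc (0:ℝ) 1}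
    (hs : D.φ i s ∈ L) (ht : D.φ i t ∈ L) : D.φ i '' Ioo s t ⊆ L := by
  have hemb := (D.continuous_φ i).isClosedEmbedding (D.injective_φ i)
  have hpre : IsPreconnected (D.φ i ⁻¹' L) := by
    rw [← hemb.isInducing.isPreconnected_image, image_preimage_eq_of_subset hLi]
    exact hL
  rintro _ ⟨u, hu, rfl⟩
  exact hpre.ordConnected.out hs ht (Ioo_subset_Icc_self hu)

end EdgeDecomposition

section Dynamics

variable {G : Type*} {f : G → G}

theorem image_iterate_add (K : Set G) (i j : ℕ) :
    f^[i + j] '' K = f^[i] '' (f^[j] '' K) := by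
  rw [Function.iterate_add, image_comp]

theorem mem_image_iterate_add {K : Set G} {p : G} {j : ℕ} (i : ℕ) (hp : p ∈ f^[j] '' K) :
    f^[i] p ∈ f^[i + j] '' K := by
  rw [image_iterate_add]; exact mem_image_of_mem _ hp

variable [TopologicalSpace G]

namespace IsPeriodicSubgraph

variable {K : Set G} {k : ℕ}

theorem image_iterate_mod_s10 (h : IsPeriodicSubgraph f K k) (i : ℕ) :
    f^[i] '' K = f^[i % k] '' K := by
  have hmul : ∀ q, f^[k * q] '' K = K := by
    intro q
    induction q with
    | zero => simp
    | succ q ih => rw [Nat.mul_succ, image_iterate_add, h.2.2.1, ih]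
  conv_lhs => rw [← Nat.mod_add_div i k, image_iterate_add, hmul]

theorem modEq_of_mem (h : IsPeriodicSubgraph f K k) {i j : ℕ} {p : G}
    (hi : p ∈ f^[i] '' K) (hj : p ∈ f^[j] '' K) : i ≡ j [MOD k] := by
  rw [h.image_iterate_mod_s10] at hi hj
  by_contra hne
  exact Set.disjoint_left.1
    (h.2.2.2 _ _ (Nat.mod_lt i h.2.1) (Nat.mod_lt j h.2.1) hne) hi hj

theorem image_iterate_congr (h : IsPeriodicSubgraph f K k) {i j : ℕ} (hij : i ≡ j [MOD k]) :
    f^[i] '' K = f^[j] '' K := by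
  rw [h.image_iterate_mod_s10 i, h.image_iterate_mod_s10 j, show i % k = j % k from hij]

theorem isPreconnected_image (h : IsPeriodicSubgraph f K k) (hf : Continuous f) (i : ℕ) :
    IsPreconnected (f^[i] '' K) :=
  h.1.2.1.isPreconnected.image _ (hf.iterate i).continuousOn

theorem isClosed_image [CompactSpace G] [T2Space G] (h : IsPeriodicSubgraph f K k)
    (hf : Continuous f) (i : ℕ) : IsClosed (f^[i] '' K) :=
  (h.1.1.isCompact.image (hf.iterate i)).isClosed

theorem mem_orbit_iff (h : IsPeriodicSubgraph f K k) {p : G} :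
    p ∈ ⋃ i ∈ Finset.range k, f^[i] '' K ↔ ∃ i, p ∈ f^[i] '' K := by
  simp only [mem_iUnion, Finset.mem_range, exists_prop]
  constructor
  · rintro ⟨i, -, hi⟩; exact ⟨i, hi⟩
  · rintro ⟨i, hi⟩
    exact ⟨i % k, Nat.mod_lt i h.2.1, h.image_iterate_mod_s10 i ▸ hi⟩

end IsPeriodicSubgraph

theorem mem_omegaSet_iff {a p : G} :
    p ∈ omegaSet f a ↔ MapClusterPt p atTop (fun n => f^[n] a) := by
  rw [mapClusterPt_atTop_iff_forall_mem_closure, omegaSet, mem_iInter]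

theorem frequently_of_mem_omegaSet {a p : G} (h : p ∈ omegaSet f a) {U : Set G}
    (hU : U ∈ 𝓝 p) : ∃ᶠ n in atTop, f^[n] a ∈ U :=
  mapClusterPt_iff_frequently.1 (mem_omegaSet_iff.1 h) U hU

theorem omegaSet_subset_of_mem (hf : Continuous f) {a p : G} (h : p ∈ omegaSet f a) :
    omegaSet f p ⊆ omegaSet f a := by
  intro q hq
  rw [mem_omegaSet_iff, mapClusterPt_iff_frequently]
  intro U hU
  obtain ⟨W, hWU, hW, hqW⟩ := mem_nhds_iff.1 hU
  rw [frequently_atTop]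
  intro N
  obtain ⟨n, hn, hnW⟩ := frequently_atTop.1 (frequently_of_mem_omegaSet hq (hW.mem_nhds hqW)) N
  obtain ⟨k, hk⟩ := (frequently_of_mem_omegaSet h
    ((hW.preimage (hf.iterate n)).mem_nhds hnW)).exists
  refine ⟨n + k, by omega, hWU ?_⟩
  rw [Function.iterate_add_apply]
  exact hk

theorem iterate_mem_omegaSet (hf : Continuous f) {a p : G} (h : p ∈ omegaSet f a) (i : ℕ) :
    f^[i] p ∈ omegaSet f a := by
  rw [mem_omegaSet_iff, mapClusterPt_iff_frequently]
  intro U hU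
  rw [frequently_atTop]
  intro N
  obtain ⟨n, hn, hnU⟩ := frequently_atTop.1
    (frequently_of_mem_omegaSet h ((hf.iterate i).continuousAt.preimage_mem_nhds hU)) N
  exact ⟨i + n, by omega, by rw [Function.iterate_add_apply]; exact hnU⟩

theorem exists_iterate_eq_of_mem_omegaSet [CompactSpace G] [T2Space G] (hf : Continuous f)
    {a p : G} (h : p ∈ omegaSet f a) (j : ℕ) : ∃ q ∈ omegaSet f a, f^[j] q = p := by
  obtain ⟨U, hU, hUp⟩ := mapClusterPt_iff_ultrafilter.1 (mem_omegaSet_iff.1 h)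
  let v : ℕ → G := fun n => f^[n - j] a
  obtain ⟨q, -, hq⟩ := isCompact_univ.ultrafilter_le_nhds (U.map v) (by simp)
  have hq' : Tendsto v U (𝓝 q) := hq
  refine ⟨q, ?_, ?_⟩
  · rw [mem_omegaSet_iff]
    have : MapClusterPt q U v := hq'.mapClusterPt
    have h2 : MapClusterPt q (Filter.map (fun n => n - j) U) (fun n => f^[n] a) := this
    exact h2.mono ((Filter.map_mono hU).trans (tendsto_sub_atTop_nat j))
  · refine tendsto_nhds_unique (((hf.iterate j).tendsto q).comp hq') (hUp.congr' ?_)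
    filter_upwards [hU (eventually_ge_atTop j)] with n hn
    simp only [Function.comp_apply, v]
    rw [← Function.iterate_add_apply, Nat.add_sub_cancel' hn]

/-- A nested sequence of periodic subgraphs whose periods tend to infinity. -/
structure IsNestedSequence (f : G → G) (J : ℕ → Set G) (m : ℕ → ℕ) : Prop where
  periodic : ∀ n, IsPeriodicSubgraph f (J n) (m n)
  antitone : Antitone J
  tendsto : Tendsto m atTop atTop

namespace IsNestedSequence

variable {J : ℕ → Set G} {m : ℕ → ℕ}

theorem exists_lt (h : IsNestedSequence f J m) (N n : ℕ) : ∃ k ≥ n, N < m k :=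
  ((h.tendsto.eventually_gt_atTop N).and (eventually_ge_atTop n)).exists.imp
    fun _ hk => ⟨hk.2, hk.1⟩

/-- A set with finite boundary separates only finitely many iterates of two points which
lie in all the subgraphs. -/
theorem finite_setOf_mem_notMem (h : IsNestedSequence f J m) (hf : Continuous f) {N : Set G}
    (hN : (frontier N).Finite) {p q : G} (hp : ∀ n, p ∈ J n) (hq : ∀ n, q ∈ J n) :
    {i | f^[i] p ∈ N ∧ f^[i] q ∉ N}.Finite := by
  by_contra hinf
  obtain ⟨T, hT, hcard⟩ := Set.Infinite.exists_subset_card_eq hinf (hN.toFinset.card + 1)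
  obtain ⟨k, -, hk⟩ := h.exists_lt (T.sup id) 0
  have hTk : ∀ i ∈ T, i < m k := fun i hi => (Finset.le_sup (f := id) hi).trans_lt hk
  have hex : ∀ i, i ∈ T → ∃ c ∈ frontier N, c ∈ f^[i] '' J k := by
    intro i hi
    by_contra! hno
    have hsub : f^[i] '' J k ⊆ interior N := by
      refine ((h.periodic k).isPreconnected_image hf i).subset_left_of_subset_union
        isOpen_interior (isClosed_closure (s := N)).isOpen_compl ?_ ?_ ?_
      · exact disjoint_compl_right.mono_left (interior_subset.trans subset_closure)
      · intro c hc
        by_contra hcon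
        rw [mem_union, not_or, mem_compl_iff, not_not] at hcon
        exact hno c ⟨hcon.2, hcon.1⟩ hc
      · have hpm : f^[i] p ∈ f^[i] '' J k := mem_image_of_mem _ (hp k)
        refine ⟨_, hpm, ?_⟩
        by_contra hcon
        exact hno _ ⟨subset_closure (hT hi).1, hcon⟩ hpm
    exact (hT hi).2 (interior_subset (hsub (mem_image_of_mem _ (hq k))))
  have : Nonempty G := ⟨p⟩
  choose! c hcN hcJ using hex
  obtain ⟨i, hi, j, hj, hij, hce⟩ := Finset.exists_ne_map_eq_of_card_lt_of_maps_to
    (s := T) (t := hN.toFinset) (f := c) (by omega) (fun i hi => by simpa using hcN i hi)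
  exact hij (((h.periodic k).modEq_of_mem (hcJ i hi) (hce ▸ hcJ j hj)).eq_of_lt_of_lt
    (hTk i hi) (hTk j hj))

theorem exists_mem_omegaSet [CompactSpace G] (h : IsNestedSequence f J m) {p : G}
    (hp : ∀ n, p ∈ J n) : ∃ w ∈ omegaSet f p, ∀ n, w ∈ J n := by
  obtain ⟨w, -, hw⟩ := isCompact_univ.exists_mapClusterPt (u := fun k => f^[m k] p)
    (f := atTop) (by simp)
  refine ⟨w, ?_, fun n => ?_⟩
  · rw [mem_omegaSet_iff]
    have h2 : MapClusterPt w (Filter.map m atTop) (fun n => f^[n] p) := hw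
    exact h2.mono h.tendsto
  · refine (h.periodic n).1.1.mem_of_mapClusterPt hw ?_
    filter_upwards [eventually_ge_atTop n] with k hk
    refine h.antitone hk ?_
    rw [← (h.periodic k).2.2.1]
    exact mem_image_of_mem _ (hp k)

theorem infinite_omegaSet [CompactSpace G] (h : IsNestedSequence f J m) (hf : Continuous f)
    {p : G} (hp : ∀ n, p ∈ J n) : (omegaSet f p).Infinite := by
  obtain ⟨w, hw, hwJ⟩ := h.exists_mem_omegaSet hp
  refine Set.infinite_of_injective_forall_mem (f := fun i => f^[i] w) ?_
    (fun i => iterate_mem_omegaSet hf hw i)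
  intro i j hij
  obtain ⟨k, -, hk⟩ := h.exists_lt (max i j) 0
  refine ((h.periodic k).modEq_of_mem (mem_image_of_mem (f^[i]) (hwJ k)) ?_).eq_of_lt_of_lt
    ((le_max_left _ _).trans_lt hk) ((le_max_right _ _).trans_lt hk)
  rw [show f^[i] w = f^[j] w from hij]
  exact mem_image_of_mem _ (hwJ k)

theorem isClosed_orbit [CompactSpace G] [T2Space G] (h : IsNestedSequence f J m)
    (hf : Continuous f) (n : ℕ) : IsClosed (⋃ i ∈ Finset.range (m n), f^[i] '' J n) :=
  isClosed_biUnion_finset fun i _ => (h.periodic n).isClosed_image hf i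

theorem omegaSet_subset_orbit_of_iterate_mem [CompactSpace G] [T2Space G]
    (h : IsNestedSequence f J m) (hf : Continuous f) {n t : ℕ} {a : G}
    (ha : f^[t] a ∈ ⋃ i ∈ Finset.range (m n), f^[i] '' J n) :
    omegaSet f a ⊆ ⋃ i ∈ Finset.range (m n), f^[i] '' J n := by
  intro q hq
  refine (h.isClosed_orbit hf n).mem_of_mapClusterPt (mem_omegaSet_iff.1 hq) ?_
  filter_upwards [eventually_ge_atTop t] with s hs
  obtain ⟨i, hi⟩ := (h.periodic n).mem_orbit_iff.1 ha
  refine (h.periodic n).mem_orbit_iff.2 ⟨s - t + i, ?_⟩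
  rw [← Nat.sub_add_cancel hs, Function.iterate_add_apply, Nat.add_sub_cancel]
  exact mem_image_iterate_add _ hi

theorem omegaSet_subset_orbit [CompactSpace G] [T2Space G] (h : IsNestedSequence f J m)
    (D : EdgeDecomposition G) (hf : Continuous f) {a p : G} (hp : ∀ n, p ∈ J n)
    (hpa : p ∈ omegaSet f a) (n : ℕ) :
    omegaSet f a ⊆ ⋃ i ∈ Finset.range (m n), f^[i] '' J n := by
  have hsub : omegaSet f p ⊆ ⋃ i ∈ Finset.range (m n), f^[i] '' J n :=
    h.omegaSet_subset_orbit_of_iterate_mem hf (t := 0)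
      ((h.periodic n).mem_orbit_iff.2 ⟨0, p, hp n, rfl⟩)
  have hfin : (⋃ i ∈ Finset.range (m n), frontier (f^[i] '' J n)).Finite :=
    (Finset.range (m n)).finite_toSet.biUnion fun i _ =>
      D.finite_frontier ((h.periodic n).isClosed_image hf i)
        ((h.periodic n).isPreconnected_image hf i)
  obtain ⟨q, hq, hqf⟩ := ((h.infinite_omegaSet hf hp).sdiff hfin).nonempty
  obtain ⟨i, hi, hqi⟩ := mem_iUnion₂.1 (hsub hq)
  have hint : q ∈ interior (f^[i] '' J n) := by
    by_contra hcon
    exact hqf (mem_iUnion₂.2 ⟨i, hi, subset_closure hqi, hcon⟩)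
  obtain ⟨t, ht⟩ := (frequently_of_mem_omegaSet (omegaSet_subset_of_mem hf hpa hq)
    (mem_interior_iff_mem_nhds.1 hint)).exists
  exact h.omegaSet_subset_orbit_of_iterate_mem hf (t := t) (mem_iUnion₂.2 ⟨i, hi, ht⟩)

theorem isSolenoid_omegaSet [CompactSpace G] [T2Space G] (h : IsNestedSequence f J m)
    (D : EdgeDecomposition G) (hf : Continuous f) {a p : G} (hp : ∀ n, p ∈ J n)
    (hpa : p ∈ omegaSet f a) : IsSolenoid f (omegaSet f a) := by
  refine ⟨(h.infinite_omegaSet hf hp).mono (omegaSet_subset_of_mem hf hpa), fun N => ?_⟩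
  obtain ⟨k, -, hk⟩ := h.exists_lt N 0
  exact ⟨_, m k, hk.le, ⟨J k, h.periodic k, rfl⟩, h.omegaSet_subset_orbit D hf hp hpa k⟩

/-- A neighbourhood of a point of `ω(f)` is not contained in an intersection of images of the
subgraphs, since such an intersection is wandering. -/
theorem not_forall_subset (h : IsNestedSequence f J m) {c q : G} (hq : q ∈ omegaSet f c)
    {U : Set G} (hU : U ∈ 𝓝 q) (s : ℕ → ℕ) (k₀ : ℕ) :
    ¬ ∀ k ≥ k₀, U ⊆ f^[s k] '' J k := by
  intro hsub
  obtain ⟨i, -, hi⟩ := frequently_atTop.1 (frequently_of_mem_omegaSet hq hU) 0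
  obtain ⟨j, hj, hjU⟩ := frequently_atTop.1 (frequently_of_mem_omegaSet hq hU) (i + 1)
  obtain ⟨k, hk, hkm⟩ := h.exists_lt (j - i) k₀
  have h1 : f^[j] c ∈ f^[(j - i) + s k] '' J k := by
    have : f^[j] c = f^[j - i] (f^[i] c) := by
      rw [← Function.iterate_add_apply, Nat.sub_add_cancel (by omega)]
    rw [this]
    exact mem_image_iterate_add _ (hsub k hk hi)
  have h2 := (h.periodic k).modEq_of_mem h1 (hsub k hk hjU)
  have h3 : j - i ≡ 0 [MOD m k] := by
    have : (j - i) + s k ≡ 0 + s k [MOD m k] := by simpa using h2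
    exact Nat.ModEq.add_right_cancel' _ this
  have := h3.eq_of_lt_of_lt hkm (by omega)
  omega

/-- The intersection of the subgraphs contains at most two points of `ω(f)`. -/
theorem eq_or_eq_of_mem_omegaUnion [CompactSpace G] [T2Space G] (h : IsNestedSequence f J m)
    (D : EdgeDecomposition G) (hf : Continuous f) {x y w : G} (hxy : x ≠ y)
    (hx : x ∈ omegaUnion f) (hy : y ∈ omegaUnion f) (hw : w ∈ omegaUnion f)
    (hxJ : ∀ n, x ∈ J n) (hyJ : ∀ n, y ∈ J n) (hwJ : ∀ n, w ∈ J n) : w = x ∨ w = y := by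
  by_contra! hne
  -- an image of some subgraph contains no vertex
  obtain ⟨k₀, -, hk₀⟩ := h.exists_lt D.finite_V.toFinset.card 0
  obtain ⟨s, hs, hsV⟩ : ∃ s < m k₀, ∀ p ∈ f^[s] '' J k₀, p ∉ D.V := by
    by_contra! hcon
    have : Nonempty G := ⟨x⟩
    choose! v hvJ hvV using hcon
    obtain ⟨i, hi, j, hj, hij, hve⟩ := Finset.exists_ne_map_eq_of_card_lt_of_maps_to
      (s := Finset.range (m k₀)) (t := D.finite_V.toFinset) (f := v) (by simpa using hk₀)
      (fun i hi => by simpa using hvV i (by simpa using hi))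
    rw [Finset.mem_range] at hi hj
    exact hij (((h.periodic k₀).modEq_of_mem (hvJ i hi) (hve ▸ hvJ j hj)).eq_of_lt_of_lt hi hj)
  set j := m k₀ - s with hj
  -- the corresponding preimages in the other subgraphs
  let σ : ℕ → ℕ := fun k => j * (m k - 1)
  have hσ : ∀ k, j + σ k ≡ 0 [MOD m k] := by
    intro k
    have hpos := (h.periodic k).2.1
    have : j + σ k = j * m k := by
      obtain ⟨r, hr⟩ := Nat.exists_eq_succ_of_ne_zero hpos.ne'
      simp only [σ, hr, Nat.succ_sub_one, Nat.mul_succ]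
      omega
    rw [this]
    exact (Nat.modEq_zero_iff_dvd).2 (dvd_mul_left _ _)
  have lift : ∀ p ∈ omegaUnion f, (∀ n, p ∈ J n) →
      ∃ q ∈ omegaUnion f, f^[j] q = p ∧ ∀ k, q ∈ f^[σ k] '' J k := by
    intro p hp hpJ
    obtain ⟨c, hc⟩ := mem_iUnion.1 hp
    obtain ⟨q, hqc, hqp⟩ := exists_iterate_eq_of_mem_omegaSet hf hc j
    refine ⟨q, mem_iUnion.2 ⟨c, hqc⟩, hqp, fun k => ?_⟩
    obtain ⟨i, hi⟩ := (h.periodic k).mem_orbit_iff.1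
      (h.omegaSet_subset_orbit D hf hpJ hc k hqc)
    have h1 : j + i ≡ 0 [MOD m k] := by
      refine (h.periodic k).modEq_of_mem (mem_image_iterate_add j hi) ?_
      rw [hqp]
      exact ⟨p, hpJ k, rfl⟩
    have h2 : i ≡ σ k [MOD m k] := Nat.ModEq.add_left_cancel' j (h1.trans (hσ k).symm)
    rwa [← (h.periodic k).image_iterate_congr h2]
  have hk₀σ : f^[σ k₀] '' J k₀ = f^[s] '' J k₀ := by
    refine (h.periodic k₀).image_iterate_congr (Nat.ModEq.add_left_cancel' j ((hσ k₀).trans ?_))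
    rw [hj, Nat.sub_add_cancel hs.le]
    exact ((Nat.modEq_zero_iff_dvd).2 dvd_rfl).symm
  obtain ⟨x', hx', hxx, hxL⟩ := lift x hx hxJ
  obtain ⟨y', hy', hyy, hyL⟩ := lift y hy hyJ
  obtain ⟨w', hw', hww, hwL⟩ := lift w hw hwJ
  have hsub : ∀ k ≥ k₀, f^[σ k] '' J k ⊆ f^[s] '' J k₀ := by
    intro k hk
    have h1 : x' ∈ f^[σ k] '' J k₀ := image_mono (h.antitone hk) (hxL k)
    have h2 := (h.periodic k₀).modEq_of_mem h1 (hxL k₀)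
    rw [← hk₀σ, ← (h.periodic k₀).image_iterate_congr h2]
    exact image_mono (h.antitone hk)
  obtain ⟨i, hi⟩ := D.exists_subset_edge ((h.periodic k₀).isPreconnected_image hf s)
    ⟨x', hsub k₀ le_rfl (hxL k₀)⟩ hsV
  have hedge : ∀ k ≥ k₀, f^[σ k] '' J k ⊆ range (D.φ i) := fun k hk =>
    ((hsub k hk).trans hi).trans (image_subset_range _ _)
  have middle : ∀ a b c : Set.Icc (0:ℝ) 1, a < b → b < c → D.φ i b ∈ omegaUnion f →
      (∀ k, D.φ i a ∈ f^[σ k] '' J k) → (∀ k, D.φ i c ∈ f^[σ k] '' J k) → False := by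
    intro a b c hab hbc hb ha hc
    obtain ⟨z, hz⟩ := mem_iUnion.1 hb
    refine h.not_forall_subset hz ((D.isOpen_image_Ioo i a c).mem_nhds ⟨b, ⟨hab, hbc⟩, rfl⟩)
      σ k₀ fun k hk => ?_
    exact D.image_Ioo_subset ((h.periodic k).isPreconnected_image hf _) (hedge k hk)
      (ha k) (hc k)
  obtain ⟨tx, rfl⟩ := hedge k₀ le_rfl (hxL k₀)
  obtain ⟨ty, rfl⟩ := hedge k₀ le_rfl (hyL k₀)
  obtain ⟨tw, rfl⟩ := hedge k₀ le_rfl (hwL k₀)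
  have hxy' : tx ≠ ty := by rintro rfl; exact hxy (hxx.symm.trans hyy)
  have hwx' : tw ≠ tx := by rintro rfl; exact hne.1 (hww.symm.trans hxx)
  have hwy' : tw ≠ ty := by rintro rfl; exact hne.2 (hww.symm.trans hyy)
  rcases lt_or_gt_of_ne hxy' with h1 | h1 <;> rcases lt_or_gt_of_ne hwx' with h2 | h2 <;>
    rcases lt_or_gt_of_ne hwy' with h3 | h3
  · exact middle _ _ _ h2 h1 hx' hwL hyL
  · exact lt_asymm (h2.trans h1) h3
  · exact middle _ _ _ h2 h3 hw' hxL hyL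
  · exact middle _ _ _ h1 h3 hy' hxL hwL
  · exact middle _ _ _ h3 h1 hy' hwL hxL
  · exact middle _ _ _ h3 h2 hw' hyL hxL
  · exact lt_asymm (h1.trans h2) h3
  · exact middle _ _ _ h1 h2 hx' hyL hwL

theorem mem_omegaSet_of_mem_omegaSet_self [CompactSpace G] [T2Space G]
    (h : IsNestedSequence f J m) (D : EdgeDecomposition G) (hf : Continuous f) {x y : G}
    (hxJ : ∀ n, x ∈ J n) (hyJ : ∀ n, y ∈ J n) (hx : x ∈ omegaSet f x) : x ∈ omegaSet f y := by
  rw [mem_omegaSet_iff, mapClusterPt_iff_frequently]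
  intro U hU
  obtain ⟨N, hN, hNU, hfin⟩ := D.exists_nhds_finite_frontier hU
  have h1 := frequently_of_mem_omegaSet hx hN
  have h2 := h.finite_setOf_mem_notMem hf hfin hxJ hyJ
  rw [← Nat.cofinite_eq_atTop] at h1 ⊢
  refine (h1.and_eventually h2.compl_mem_cofinite).mono ?_
  rintro n ⟨hn, hn'⟩
  by_contra hcon
  exact hn' ⟨hn, fun hy => hcon (hNU hy)⟩

theorem not_separablePoints [CompactSpace G] [T2Space G] (h : IsNestedSequence f J m)
    (D : EdgeDecomposition G) (hf : Continuous f) {x y : G}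
    (hxJ : ∀ n, x ∈ J n) (hyJ : ∀ n, y ∈ J n) : ¬ SeparablePoints f x y := by
  rintro ⟨I, K, k, l, hI, hK, hdisj, hx, hy⟩
  have hfin := h.finite_setOf_mem_notMem hf
    (D.finite_frontier hI.1.1 hI.1.2.1.isPreconnected) hxJ hyJ
  have hpos : 0 < k * l := Nat.mul_pos hI.2.1 hK.2.1
  refine Set.infinite_of_injective_forall_mem (f := fun i => k * l * i)
    (fun i j hij => Nat.eq_of_mul_eq_mul_left hpos hij) (fun i => ?_) hfin
  have h1 : f^[k * l * i] '' I = I := by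
    rw [hI.image_iterate_congr (j := 0)
      ((Nat.modEq_zero_iff_dvd).2 ⟨l * i, by ring⟩)]
    simp
  have h2 : f^[k * l * i] '' K = K := by
    rw [hK.image_iterate_congr (j := 0)
      ((Nat.modEq_zero_iff_dvd).2 ⟨k * i, by ring⟩)]
    simp
  exact ⟨h1 ▸ mem_image_of_mem _ hx,
    fun hyI => Set.disjoint_left.1 hdisj hyI (h2 ▸ mem_image_of_mem _ hy)⟩

end IsNestedSequence

end Dynamics

/-- If two distinct points `x, y ∈ ω(f)` lie in a nested sequence of periodic
subgraphs with periods tending to infinity, then they lie in a common ω-limit set,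
the sets `ω_f(x)`, `ω_f(y)`, `ω_f(z)` are solenoids, and `x, y` are non-separable. -/
theorem nested_periodic_subgraphs_nonseparable {G : Type*} [MetricSpace G]
    (hG : IsTopGraph G) (f : G → G) (hf : Continuous f) (x y : G) (hxy : x ≠ y)
    (hx : x ∈ omegaUnion f) (hy : y ∈ omegaUnion f)
    (J : ℕ → Set G) (m : ℕ → ℕ)
    (hJ : ∀ n, IsPeriodicSubgraph f (J n) (m n))
    (hnest : ∀ n, J (n + 1) ⊆ J n)
    (hm : Filter.Tendsto m Filter.atTop Filter.atTop)
    (hmem : ∀ n, x ∈ J n ∧ y ∈ J n) :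
    (∃ z : G, x ∈ omegaSet f z ∧ y ∈ omegaSet f z ∧ IsSolenoid f (omegaSet f z)) ∧
    IsSolenoid f (omegaSet f x) ∧ IsSolenoid f (omegaSet f y) ∧
    ¬ SeparablePoints f x y := by
  have := hG.1
  obtain ⟨D⟩ := hG.nonempty_edgeDecomposition
  have h : IsNestedSequence f J m := ⟨hJ, antitone_nat_of_succ_le hnest, hm⟩
  have hxJ := fun n => (hmem n).1
  have hyJ := fun n => (hmem n).2
  obtain ⟨a, ha⟩ := mem_iUnion.1 hx
  obtain ⟨b, hb⟩ := mem_iUnion.1 hy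
  have hself : ∀ p, (∀ n, p ∈ J n) → IsSolenoid f (omegaSet f p) := by
    intro p hp
    refine ⟨h.infinite_omegaSet hf hp, fun N => ?_⟩
    obtain ⟨k, -, hk⟩ := h.exists_lt N 0
    exact ⟨_, m k, hk.le, ⟨J k, h.periodic k, rfl⟩,
      h.omegaSet_subset_orbit_of_iterate_mem hf (t := 0)
        ((h.periodic k).mem_orbit_iff.2 ⟨0, p, hp k, rfl⟩)⟩
  refine ⟨?_, hself x hxJ, hself y hyJ, h.not_separablePoints D hf hxJ hyJ⟩
  obtain ⟨w, hw, hwJ⟩ := h.exists_mem_omegaSet hxJ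
  rcases h.eq_or_eq_of_mem_omegaUnion D hf hxy hx hy (mem_iUnion.2 ⟨x, hw⟩) hxJ hyJ hwJ
    with rfl | rfl
  · exact ⟨b, omegaSet_subset_of_mem hf hb
      (h.mem_omegaSet_of_mem_omegaSet_self D hf hxJ hyJ hw), hb,
      h.isSolenoid_omegaSet D hf hyJ hb⟩
  · exact ⟨a, ha, omegaSet_subset_of_mem hf ha hw, h.isSolenoid_omegaSet D hf hxJ ha⟩
end
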